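/- For any tree T with at least four vertices, μ'(T) ≥ 2, with equality only if T is isomorphic to the path on four vertices P₄. -/

import Mathlib

open SimpleGraph Finset BigOperators Filter

attribute [local instance] Classical.propDecidable

/-- A finset of vertices induces a subtree of `G`: it is nonempty and its induced
subgraph is connected. -/
def SimpleGraph.IsSubtree {V : Type*} (G : SimpleGraph V) (s : Finset V) : Prop :=
  s.Nonempty ∧ (G.induce (s : Set V)).Connected

/-- The collection of all subtrees of `G` (as finsets of vertices). -/
noncomputable def subtreeFinset {V : Type*} [Fintype V] (G : SimpleGraph V) :
    Finset (Finset V) :=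
  Finset.univ.filter G.IsSubtree

/-- `𝒮'(G)`: the collection obtained from the collection of subtrees of `G` by
adding the empty set and removing the singleton `{v}` for every leaf `v`. -/
noncomputable def subtreeFinset' {V : Type*} [Fintype V] (G : SimpleGraph V) :
    Finset (Finset V) :=
  insert ∅ ((subtreeFinset G).filter (fun s => ¬ ∃ v, G.degree v = 1 ∧ s = {v}))

/-- `μ'(G)`: the average cardinality of a member of `𝒮'(G)`. -/
noncomputable def mu' {V : Type*} [Fintype V] (G : SimpleGraph V) : ℚ :=
  (∑ s ∈ subtreeFinset' G, (s.card : ℚ)) / ((subtreeFinset' G).card : ℚ)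

open scoped Finset

namespace SimpleGraph

variable {V : Type*} {G : SimpleGraph V}

lemma IsAcyclic.not_adj_of_common_neighbor (hG : G.IsAcyclic) {u v w : V}
    (huv : G.Adj u v) (hvw : G.Adj v w) : ¬ G.Adj w u := by
  intro hwu
  refine hG (Walk.cons huv (Walk.cons hvw (Walk.cons hwu Walk.nil))) ?_
  have := huv.ne
  have := hvw.ne
  have := hwu.ne
  rw [Walk.cons_isCycle_iff]
  constructor
  · simp [Walk.isPath_def, *, Ne.symm]
  · simp
    grind

lemma isSubtree_insert_of_forall_adj {v : V} {s : Finset V}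
    (hs : ∀ a ∈ s, G.Adj v a) : G.IsSubtree (insert v s) := by
  refine ⟨⟨v, mem_insert_self v s⟩, ?_⟩
  rw [connected_iff_exists_forall_reachable]
  refine ⟨⟨v, by simp⟩, ?_⟩
  rintro ⟨w, hw⟩
  simp only [coe_insert, Set.mem_insert_iff, mem_coe] at hw
  obtain rfl | hw := hw
  · exact Reachable.refl _
  · refine Adj.reachable ?_
    simpa using hs w hw

lemma isSubtree_singleton (v : V) : G.IsSubtree {v} := by
  simpa using isSubtree_insert_of_forall_adj (G := G) (v := v) (s := ∅) (by simp)

lemma Connected.isSubtree_univ [Fintype V] (hG : G.Connected) :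
    G.IsSubtree (univ : Finset V) := by
  have := hG.nonempty
  refine ⟨univ_nonempty, ?_⟩
  rw [coe_univ]
  exact (induceUnivIso G).connected_iff.mpr hG

/-- A three-vertex subtree of an acyclic graph determines its centre. -/
lemma IsAcyclic.eq_of_insert_eq_insert (hG : G.IsAcyclic) {v w : V} {s t : Finset V}
    (hs : ∀ a ∈ s, G.Adj v a) (ht : ∀ a ∈ t, G.Adj w a) (hs2 : #s = 2)
    (h : insert v s = insert w t) : v = w ∧ s = t := by
  have hvs : v ∉ s := fun hv => (hs v hv).ne rfl
  have hwt : w ∉ t := fun hw => (ht w hw).ne rfl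
  obtain rfl | hvw := eq_or_ne v w
  · refine ⟨rfl, ?_⟩
    rw [← erase_insert hvs, h, erase_insert hwt]
  · exfalso
    have hws : w ∈ s := by
      have : w ∈ insert v s := h ▸ mem_insert_self w t
      exact (mem_insert.mp this).resolve_left hvw.symm
    obtain ⟨c, hc, hcw⟩ := exists_mem_ne (by omega : 1 < #s) w
    have hct : c ∈ t := by
      have : c ∈ insert w t := h ▸ mem_insert_of_mem hc
      exact (mem_insert.mp this).resolve_left hcw
    exact hG.not_adj_of_common_neighbor (hs w hws) (ht c hct) (hs c hc).symm

variable [Fintype V]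

/-- The three-vertex subtrees of an acyclic graph, each as a centre with two neighbours. -/
noncomputable def cherries (G : SimpleGraph V) : Finset (Finset V) :=
  (univ.sigma fun v => (G.neighborFinset v).powersetCard 2).image fun p => insert p.1 p.2

lemma mem_cherries {s : Finset V} :
    s ∈ G.cherries ↔ ∃ v t, (∀ a ∈ t, G.Adj v a) ∧ #t = 2 ∧ insert v t = s := by
  simp [cherries, mem_powersetCard, subset_iff, and_assoc]

lemma card_eq_three_of_mem_cherries {s : Finset V} (hs : s ∈ G.cherries) : #s = 3 := by
  obtain ⟨v, t, hvt, ht, rfl⟩ := mem_cherries.mp hs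
  rw [card_insert_of_notMem fun hv => (hvt v hv).ne rfl, ht]

lemma IsAcyclic.card_cherries (hG : G.IsAcyclic) :
    #G.cherries = ∑ v, (G.degree v).choose 2 := by
  rw [cherries, card_image_of_injOn]
  · simp
  · rintro ⟨v, s⟩ hs ⟨w, t⟩ ht h
    simp only [coe_sigma, Set.mem_sigma_iff, mem_coe, mem_powersetCard, subset_iff,
      mem_neighborFinset] at hs ht
    obtain ⟨rfl, rfl⟩ := hG.eq_of_insert_eq_insert hs.2.1 ht.2.1 hs.2.2 h
    rfl

/-- The vertices that are not leaves. -/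
noncomputable def internalVertices (G : SimpleGraph V) : Finset V :=
  {v | G.degree v ≠ 1}

lemma eq_empty_or_singleton_of_mem_subtreeFinset' {s : Finset V} (hs : s ∈ subtreeFinset' G)
    (hs2 : #s < 2) : s = ∅ ∨ s ∈ G.internalVertices.image singleton := by
  simp only [subtreeFinset', mem_insert, mem_filter] at hs
  obtain rfl | ⟨hs, hleaf⟩ := hs
  · exact Or.inl rfl
  · obtain h0 | h1 : #s = 0 ∨ #s = 1 := by omega
    · exact Or.inl (card_eq_zero.mp h0)
    · obtain ⟨v, rfl⟩ := card_eq_one.mp h1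
      refine Or.inr (mem_image_of_mem _ ?_)
      simpa [internalVertices] using hleaf

lemma mem_subtreeFinset'_of_two_le_card {s : Finset V} (hs : G.IsSubtree s) (hs2 : 2 ≤ #s) :
    s ∈ subtreeFinset' G := by
  simp only [subtreeFinset', subtreeFinset, mem_insert, mem_filter, mem_univ, true_and]
  refine Or.inr ⟨hs, ?_⟩
  rintro ⟨v, -, rfl⟩
  simp at hs2

lemma IsTree.le_sum_card_sub_two (hG : G.IsTree) (hn : 4 ≤ Fintype.card V) :
    ((Fintype.card V : ℤ) - 4) + (∑ v, ((G.degree v).choose 2 : ℤ) - #G.internalVertices) ≤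
      ∑ s ∈ subtreeFinset' G, ((#s : ℤ) - 2) := by
  set I : Finset (Finset V) := G.internalVertices.image singleton with hI
  have hIcard : ∀ s ∈ I, #s = 1 := by
    intro s hs
    obtain ⟨v, -, rfl⟩ := mem_image.mp hs
    exact card_singleton v
  have hsub : insert ∅ (insert univ (I ∪ G.cherries)) ⊆ subtreeFinset' G := by
    intro s hs
    simp only [mem_insert, mem_union] at hs
    obtain rfl | rfl | hs | hs := hs
    · exact mem_insert_self _ _
    · exact mem_subtreeFinset'_of_two_le_card hG.connected.isSubtree_univ
        (by rw [card_univ]; omega)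
    · obtain ⟨v, hv, rfl⟩ := mem_image.mp hs
      simp only [internalVertices, mem_filter, mem_univ, true_and] at hv
      simp only [subtreeFinset', subtreeFinset, mem_insert, mem_filter, mem_univ, true_and]
      refine Or.inr ⟨isSubtree_singleton v, ?_⟩
      rintro ⟨w, hw, hvw⟩
      exact hv (singleton_injective hvw ▸ hw)
    · have h3 := card_eq_three_of_mem_cherries hs
      obtain ⟨v, t, hvt, -, rfl⟩ := mem_cherries.mp hs
      exact mem_subtreeFinset'_of_two_le_card (isSubtree_insert_of_forall_adj hvt)
        (by omega)
  refine le_trans (le_of_eq ?_) (sum_le_sum_of_subset_of_nonneg hsub ?_)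
  · have hdisj : Disjoint I G.cherries := by
      rw [Finset.disjoint_left]
      intro s hs hs'
      have := hIcard s hs
      have := card_eq_three_of_mem_cherries hs'
      omega
    have huniv : (univ : Finset V) ∉ I ∪ G.cherries := by
      rw [mem_union]
      rintro (h | h)
      · have := hIcard _ h
        rw [card_univ] at this
        omega
      · have := card_eq_three_of_mem_cherries h
        rw [card_univ] at this
        omega
    have hempty : (∅ : Finset V) ∉ insert univ (I ∪ G.cherries) := by
      rw [mem_insert, mem_union]
      rintro (h | h | h)
      · have := congrArg card h
        rw [card_univ, card_empty] at this
        omega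
      · simpa using hIcard _ h
      · simpa using card_eq_three_of_mem_cherries h
    rw [sum_insert hempty, sum_insert huniv, sum_union hdisj,
      sum_congr (s₁ := I) rfl (g := fun _ => (-1 : ℤ)) fun s hs => by rw [hIcard s hs]; norm_num,
      sum_congr (s₁ := G.cherries) rfl (g := fun _ => (1 : ℤ)) fun s hs => by
        rw [card_eq_three_of_mem_cherries hs]; norm_num]
    simp only [sum_const, hI, card_image_of_injective _ singleton_injective, card_empty, card_univ,
      hG.isAcyclic.card_cherries]
    push_cast
    simp
    ring
  · intro s hs hs'
    by_contra! hneg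
    obtain rfl | h := eq_empty_or_singleton_of_mem_subtreeFinset' hs (by omega)
    · exact hs' (mem_insert_self _ _)
    · exact hs' (by simp [hI, h])

lemma sum_choose_degree_sub_ite :
    ∑ v, (((G.degree v).choose 2 : ℤ) - if G.degree v ≠ 1 then 1 else 0) =
      ∑ v, ((G.degree v).choose 2 : ℤ) - #G.internalVertices := by
  rw [sum_sub_distrib, internalVertices, card_filter]
  push_cast
  rfl

section

attribute [local instance] Fintype.decidableForallFintype Fintype.decidableExistsFintype
  instDecidableForall instDecidableIff instDecidableOr Nat.decLe instDecidableEqNat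
  instDecidableEqBool instDecidableEqFin

lemma exists_perm_of_six_edge_indicators : ∀ a b c d e f : Bool,
    1 ≤ a.toNat + b.toNat + c.toNat → 1 ≤ a.toNat + d.toNat + e.toNat →
    1 ≤ b.toNat + d.toNat + f.toNat → 1 ≤ c.toNat + e.toNat + f.toNat →
    a.toNat + b.toNat + c.toNat ≤ 2 → a.toNat + d.toNat + e.toNat ≤ 2 →
    b.toNat + d.toNat + f.toNat ≤ 2 → c.toNat + e.toNat + f.toNat ≤ 2 →
    a.toNat + b.toNat + c.toNat + d.toNat + e.toNat + f.toNat = 3 →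
    ∃ σ : Equiv.Perm (Fin 4), ∀ i j,
      (![![false, a, b, c], ![a, false, d, e], ![b, d, false, f], ![c, e, f, false]] :
        Fin 4 → Fin 4 → Bool) i j = true ↔
        (σ i).val + 1 = (σ j).val ∨ (σ j).val + 1 = (σ i).val := by
  decide +kernel

end

lemma exists_perm_pathGraph_four (b : Fin 4 → Fin 4 → Bool) (hsymm : ∀ i j, b i j = b j i)
    (hirr : ∀ i, b i i = false) (hpos : ∀ i, 1 ≤ ∑ j, (b i j).toNat)
    (hle : ∀ i, ∑ j, (b i j).toNat ≤ 2) (hsum : ∑ i, ∑ j, (b i j).toNat = 6) :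
    ∃ σ : Equiv.Perm (Fin 4), ∀ i j, b i j = true ↔ (pathGraph 4).Adj (σ i) (σ j) := by
  have hb : b = ![![false, b 0 1, b 0 2, b 0 3], ![b 0 1, false, b 1 2, b 1 3],
      ![b 0 2, b 1 2, false, b 2 3], ![b 0 3, b 1 3, b 2 3, false]] := by
    ext i j
    fin_cases i <;> fin_cases j <;> simp [hirr, hsymm 1 0, hsymm 2 0, hsymm 3 0, hsymm 2 1,
      hsymm 3 1, hsymm 3 2]
  have hpos := And.intro (hpos 0) (And.intro (hpos 1) (And.intro (hpos 2) (hpos 3)))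
  have hle := And.intro (hle 0) (And.intro (hle 1) (And.intro (hle 2) (hle 3)))
  simp only [Fin.sum_univ_four, hirr, hsymm 1 0, hsymm 2 0, hsymm 3 0,
    hsymm 2 1, hsymm 3 1, hsymm 3 2, Bool.toNat_false] at hpos hle hsum
  obtain ⟨σ, hσ⟩ := exists_perm_of_six_edge_indicators (b 0 1) (b 0 2) (b 0 3) (b 1 2) (b 1 3) (b 2 3)
    (by omega) (by omega) (by omega) (by omega) (by omega) (by omega) (by omega) (by omega)
    (by omega)
  refine ⟨σ, fun i j => ?_⟩
  rw [hb, pathGraph_adj]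
  exact hσ i j

lemma IsTree.nonempty_iso_pathGraph_four (hG : G.IsTree) (hn : Fintype.card V = 4)
    (hle : ∀ v, G.degree v ≤ 2) : Nonempty (G ≃g pathGraph 4) := by
  have e : V ≃ Fin 4 := Fintype.equivFinOfCardEq hn
  have : Nontrivial V := Fintype.one_lt_card_iff_nontrivial.mp (by omega)
  let b : Fin 4 → Fin 4 → Bool := fun i j => decide (G.Adj (e.symm i) (e.symm j))
  have hdeg : ∀ i, ∑ j, (b i j).toNat = G.degree (e.symm i) := by
    intro i
    rw [Equiv.sum_comp e.symm fun w => (decide (G.Adj (e.symm i) w)).toNat,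
      ← card_neighborFinset_eq_degree, neighborFinset_eq_filter, card_filter]
    refine sum_congr rfl fun w _ => ?_
    by_cases h : G.Adj (e.symm i) w <;> simp [h]
  obtain ⟨σ, hσ⟩ := exists_perm_pathGraph_four b (fun i j => by simp [b, G.adj_comm])
    (fun i => by simp [b])
    (fun i => by
      rw [hdeg]
      exact hG.connected.preconnected.degree_pos_of_nontrivial _)
    (fun i => by rw [hdeg]; exact hle _)
    (by
      simp_rw [hdeg]
      rw [Equiv.sum_comp e.symm fun v => G.degree v, sum_degrees_eq_twice_card_edges]
      have := hG.card_edgeFinset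
      omega)
  refine ⟨⟨e.trans σ, ?_⟩⟩
  intro v w
  simp [← hσ, b]

end SimpleGraph

/-- For any tree `T` with at least four vertices, `μ'(T) ≥ 2`, with equality only
if `T` is isomorphic to the path on four vertices. -/
theorem two_le_mu' {V : Type*} [Fintype V] (G : SimpleGraph V) (hT : G.IsTree)
    (hn : 4 ≤ Fintype.card V) :
    2 ≤ mu' G ∧ (mu' G = 2 → Nonempty (G ≃g SimpleGraph.pathGraph 4)) := by
  have hbound := hT.le_sum_card_sub_two hn
  rw [← sum_choose_degree_sub_ite] at hbound
  have : Nontrivial V := Fintype.one_lt_card_iff_nontrivial.mp (by omega)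
  have hterm : ∀ v ∈ (univ : Finset V),
      0 ≤ ((G.degree v).choose 2 : ℤ) - if G.degree v ≠ 1 then 1 else 0 := by
    intro v _
    have hpos := hT.connected.preconnected.degree_pos_of_nontrivial v
    split_ifs with h
    · have := Nat.choose_pos (show 2 ≤ G.degree v by omega)
      omega
    · simp
  have hsum := sum_nonneg hterm
  have hcard : (0 : ℚ) < #(subtreeFinset' G) := by
    exact_mod_cast card_pos.mpr ⟨∅, mem_insert_self _ _⟩
  have hcast : ∑ s ∈ subtreeFinset' G, (#s : ℚ) =
      ((∑ s ∈ subtreeFinset' G, ((#s : ℤ) - 2) : ℤ) : ℚ) + 2 * #(subtreeFinset' G) := by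
    push_cast
    rw [sum_sub_distrib, sum_const, nsmul_eq_mul]
    ring
  constructor
  · rw [mu', le_div_iff₀ hcard, hcast, le_add_iff_nonneg_left]
    exact_mod_cast (by omega : 0 ≤ ∑ s ∈ subtreeFinset' G, ((#s : ℤ) - 2))
  · intro heq
    rw [mu', div_eq_iff hcard.ne', hcast, add_eq_right] at heq
    have hzero : ∑ s ∈ subtreeFinset' G, ((#s : ℤ) - 2) = 0 := by exact_mod_cast heq
    refine hT.nonempty_iso_pathGraph_four (by omega) fun v => ?_
    have hv := (sum_eq_zero_iff_of_nonneg hterm).mp (by omega) v (mem_univ v)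
    by_contra! hdeg
    have h3 : Nat.choose 3 2 ≤ (G.degree v).choose 2 := Nat.choose_le_choose 2 hdeg
    rw [if_pos (by omega), show Nat.choose 3 2 = 3 from rfl] at *
    omega
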